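/- Four-partite monogamy in the tree network: Label 9 qubits by 0, 1, 2, 3, 4, 5, 6, 7, 8 (where 5,6,7,8 are copies 1̃,2̃,3̃,4̃ of 1,2,3,4). For every 9-qubit density matrix ρ, the xy-plane Bell strengths of the eight quadruples satisfy 𝒯²₀₁₂₃(ρ) + 𝒯²₀₂₃₄(ρ) + 𝒯²₀₃₄₁(ρ) + 𝒯²₀₄₁₂(ρ) + 𝒯²₀₅₆₇(ρ) + 𝒯²₀₆₇₈(ρ) + 𝒯²₀₇₈₅(ρ) + 𝒯²₀₈₅₆(ρ) ≤ 8. -/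

import Mathlib

open Matrix Complex ComplexOrder

noncomputable section

/-- The Pauli X matrix. -/
def pX : Matrix (Fin 2) (Fin 2) ℂ := !![0, 1; 1, 0]

/-- The Pauli Y matrix. -/
def pY : Matrix (Fin 2) (Fin 2) ℂ := !![0, -Complex.I; Complex.I, 0]

/-- The Pauli Z matrix. -/
def pZ : Matrix (Fin 2) (Fin 2) ℂ := !![1, 0; 0, -1]

/-- The operator on `n` qubits acting as the single-qubit operator `M` on qubit `i`
and as the identity on all other qubits. -/
def onQubit {n : ℕ} (M : Matrix (Fin 2) (Fin 2) ℂ) (i : Fin n) :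
    Matrix (Fin n → Fin 2) (Fin n → Fin 2) ℂ :=
  Matrix.of fun a b => ∏ s, if s = i then M (a s) (b s) else (if a s = b s then 1 else 0)

/-- An `n`-qubit density matrix: positive semidefinite with unit trace. -/
def IsDensityMatrix {n : ℕ} (ρ : Matrix (Fin n → Fin 2) (Fin n → Fin 2) ℂ) : Prop :=
  ρ.PosSemidef ∧ ρ.trace = 1

/-- The two Pauli matrices spanning the xy plane. -/
def XY : Fin 2 → Matrix (Fin 2) (Fin 2) ℂ := ![pX, pY]

/-- The two Pauli matrices spanning the xz plane. -/
def XZ : Fin 2 → Matrix (Fin 2) (Fin 2) ℂ := ![pX, pZ]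

/-- The xy-plane Bell strength 𝒯²_{ij}(ρ) of the pair of qubits (i,j). -/
def T2pair {n : ℕ} (ρ : Matrix (Fin n → Fin 2) (Fin n → Fin 2) ℂ) (i j : Fin n) : ℝ :=
  ∑ k : Fin 2, ∑ l : Fin 2,
    ((ρ * (onQubit (XY k) i * onQubit (XY l) j)).trace.re) ^ 2

/-- The xy-plane Bell strength 𝒯²_{ijm}(ρ) of the triple of qubits (i,j,m). -/
def T2triple {n : ℕ} (ρ : Matrix (Fin n → Fin 2) (Fin n → Fin 2) ℂ) (i j m : Fin n) : ℝ :=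
  ∑ k : Fin 2, ∑ l : Fin 2, ∑ p : Fin 2,
    ((ρ * (onQubit (XY k) i * onQubit (XY l) j * onQubit (XY p) m)).trace.re) ^ 2

/-- The xy-plane Bell strength 𝒯²_{ijml}(ρ) of the quadruple of qubits (i,j,m,l). -/
def T2quad {n : ℕ} (ρ : Matrix (Fin n → Fin 2) (Fin n → Fin 2) ℂ) (i j m l : Fin n) : ℝ :=
  ∑ k : Fin 2, ∑ k' : Fin 2, ∑ k'' : Fin 2, ∑ k''' : Fin 2,
    ((ρ * (onQubit (XY k) i * onQubit (XY k') j * onQubit (XY k'') m *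
        onQubit (XY k''') l)).trace.re) ^ 2

/-- The xz-plane Bell strength of the pair of qubits (i,j). -/
def T2pairXZ {n : ℕ} (ρ : Matrix (Fin n → Fin 2) (Fin n → Fin 2) ℂ) (i j : Fin n) : ℝ :=
  ∑ k : Fin 2, ∑ l : Fin 2,
    ((ρ * (onQubit (XZ k) i * onQubit (XZ l) j)).trace.re) ^ 2

/-- For a state `ρ` and pairwise anticommuting Hermitian involutions, the squared expectation values
sum to at most one. -/
theorem sum_sq_expectation_le_one {m ι : Type*} [Fintype m] [DecidableEq m] [Fintype ι]
    [DecidableEq ι] {ρ : Matrix m m ℂ} (hρ : ρ.PosSemidef) (htr : ρ.trace = 1)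
    (A : ι → Matrix m m ℂ) (hA : ∀ i, (A i)ᴴ = A i) (hsq : ∀ i, A i * A i = 1)
    (hanti : ∀ i j, i ≠ j → A i * A j = -(A j * A i)) :
    ∑ i, ((ρ * A i).trace.re) ^ 2 ≤ 1 := by
  set a : ι → ℝ := fun i => (ρ * A i).trace.re
  set B : Matrix m m ℂ := ∑ i, (a i : ℂ) • A i with hB
  have hBH : Bᴴ = B := by
    simp [hB, Matrix.conjTranspose_sum, Matrix.conjTranspose_smul, hA]
  have hBB : B * B = (∑ i, (a i : ℂ) ^ 2) • (1 : Matrix m m ℂ) := by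
    have h1 : B * B = ∑ i, ∑ j, ((a i : ℂ) * a j) • (A i * A j) := by
      simp only [hB, Finset.sum_mul_sum, smul_mul_smul_comm]
    have h2 : B * B = ∑ i, ∑ j, ((a i : ℂ) * a j) • (A j * A i) := by
      rw [h1, Finset.sum_comm]
      exact Finset.sum_congr rfl fun i _ => Finset.sum_congr rfl fun j _ => by
        rw [mul_comm (a i : ℂ)]
    have h3 : (2 : ℂ) • (B * B) = (2 : ℂ) • ((∑ i, (a i : ℂ) ^ 2) • (1 : Matrix m m ℂ)) := by
      have h4 : ∀ i j, ((a i : ℂ) * a j) • (A i * A j) + ((a i : ℂ) * a j) • (A j * A i) =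
          if i = j then (2 * (a i : ℂ) ^ 2) • (1 : Matrix m m ℂ) else 0 := by
        intro i j
        split_ifs with h
        · subst h
          rw [hsq, ← add_smul]
          congr 1
          ring
        · rw [hanti i j h, smul_neg, neg_add_cancel]
      rw [two_smul]
      nth_rewrite 1 [h1]
      rw [h2]
      simp only [← Finset.sum_add_distrib, h4, Finset.sum_ite_eq, Finset.mem_univ, if_true]
      rw [← Finset.sum_smul, ← Finset.mul_sum, smul_smul]
    exact smul_right_injective _ (two_ne_zero : (2 : ℂ) ≠ 0) h3
  have htrB : (ρ * B).trace.re = ∑ i, a i ^ 2 := by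
    simp only [hB, Finset.mul_sum, Matrix.trace_sum, Matrix.mul_smul, Matrix.trace_smul,
      Complex.re_sum, smul_eq_mul, Complex.re_ofReal_mul]
    exact Finset.sum_congr rfl fun i _ => by rw [sq]
  have hpos : 0 ≤ ((1 - B) * ρ * (1 - B)ᴴ).trace :=
    (hρ.mul_mul_conjTranspose_same (1 - B)).trace_nonneg
  have hexp : ((1 - B) * ρ * (1 - B)ᴴ).trace =
      1 - 2 * (ρ * B).trace + ∑ i, (a i : ℂ) ^ 2 := by
    rw [Matrix.conjTranspose_sub, hBH, Matrix.conjTranspose_one, Matrix.trace_mul_comm,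
      ← mul_assoc, Matrix.trace_mul_comm]
    have : ρ * ((1 - B) * (1 - B)) = ρ - ρ * B - ρ * B + ρ * (B * B) := by noncomm_ring
    rw [this, hBB]
    simp only [Matrix.trace_add, Matrix.trace_sub, Matrix.mul_smul, mul_one, Matrix.trace_smul,
      htr, smul_eq_mul]
    ring
  have hre := (Complex.le_def.1 hpos).1
  rw [hexp] at hre
  have hcast : (∑ i, (a i : ℂ) ^ 2) = ((∑ i, a i ^ 2 : ℝ) : ℂ) := by push_cast; rfl
  rw [hcast] at hre
  simp only [Complex.add_re, Complex.sub_re, Complex.one_re, Complex.ofReal_re, Complex.zero_re,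
    Complex.mul_re, Complex.re_ofNat, Complex.im_ofNat, htrB] at hre
  linarith

section Qubits

variable {n : ℕ}

/-- The operator on `n` qubits acting as `A s` on qubit `s`. -/
def tensorOp (A : Fin n → Matrix (Fin 2) (Fin 2) ℂ) : Matrix (Fin n → Fin 2) (Fin n → Fin 2) ℂ :=
  Matrix.of fun a b => ∏ s, A s (a s) (b s)

theorem tensorOp_mul (A B : Fin n → Matrix (Fin 2) (Fin 2) ℂ) :
    tensorOp A * tensorOp B = tensorOp (A * B) := by
  ext a b
  simp only [tensorOp, Matrix.mul_apply, Matrix.of_apply, Pi.mul_apply, ← Finset.prod_mul_distrib]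
  rw [Finset.prod_univ_sum, Fintype.piFinset_univ]

theorem tensorOp_one : tensorOp (1 : Fin n → Matrix (Fin 2) (Fin 2) ℂ) = 1 := by
  ext a b
  simp only [tensorOp, Matrix.of_apply, Pi.one_apply, Matrix.one_apply, Finset.prod_ite_zero,
    Finset.prod_const_one, Finset.mem_univ, true_imp_iff, funext_iff]

theorem onQubit_eq_tensorOp (M : Matrix (Fin 2) (Fin 2) ℂ) (i : Fin n) :
    onQubit M i = tensorOp (Pi.mulSingle i M) := by
  ext a b
  simp only [onQubit, tensorOp, Matrix.of_apply]
  refine Finset.prod_congr rfl fun s _ => ?_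
  by_cases h : s = i
  · subst h
    simp
  · simp [h, Matrix.one_apply]

theorem onQubit_mul (M N : Matrix (Fin 2) (Fin 2) ℂ) (i : Fin n) :
    onQubit M i * onQubit N i = onQubit (M * N) i := by
  simp only [onQubit_eq_tensorOp, tensorOp_mul, Pi.mulSingle_mul]

theorem onQubit_one (i : Fin n) : onQubit 1 i = 1 := by
  rw [onQubit_eq_tensorOp, Pi.mulSingle_one, tensorOp_one]

theorem onQubit_commute (M N : Matrix (Fin 2) (Fin 2) ℂ) {i j : Fin n} (h : i ≠ j) :
    onQubit M i * onQubit N j = onQubit N j * onQubit M i := by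
  simp only [onQubit_eq_tensorOp, tensorOp_mul]
  have hMN : Commute (Pi.mulSingle i M : Fin n → Matrix (Fin 2) (Fin 2) ℂ) (Pi.mulSingle j N) :=
    Pi.mulSingle_commute (f := fun _ : Fin n => Matrix (Fin 2) (Fin 2) ℂ) h M N
  rw [hMN.eq]

theorem onQubit_neg (M : Matrix (Fin 2) (Fin 2) ℂ) (i : Fin n) :
    onQubit (-M) i = -onQubit M i := by
  ext a b
  have h : ∀ s, (if s = i then -M (a s) (b s) else if a s = b s then 1 else 0) =
      (if s = i then -1 else 1) *
        (if s = i then M (a s) (b s) else if a s = b s then 1 else 0) := by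
    intro s
    split_ifs <;> simp
  simp only [onQubit, Matrix.of_apply, Matrix.neg_apply]
  rw [Finset.prod_congr rfl fun s _ => h s, Finset.prod_mul_distrib]
  simp

theorem onQubit_conjTranspose (M : Matrix (Fin 2) (Fin 2) ℂ) (i : Fin n) :
    (onQubit M i)ᴴ = onQubit Mᴴ i := by
  ext a b
  simp only [onQubit, Matrix.conjTranspose_apply, Matrix.of_apply, star_prod]
  refine Finset.prod_congr rfl fun s _ => ?_
  split_ifs <;> simp_all

theorem XY_conjTranspose (k : Fin 2) : (XY k)ᴴ = XY k := by
  fin_cases k <;> ext a b <;> fin_cases a <;> fin_cases b <;> simp [XY, pX, pY]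

theorem XY_mul_self (k : Fin 2) : XY k * XY k = 1 := by
  fin_cases k <;> ext a b <;> fin_cases a <;> fin_cases b <;> simp [XY, pX, pY]

theorem XY_anticommute {k l : Fin 2} (h : k ≠ l) : XY k * XY l = -(XY l * XY k) := by
  fin_cases k <;> fin_cases l <;> first | exact absurd rfl h | skip
  all_goals ext a b; fin_cases a <;> fin_cases b <;> simp [XY, pX, pY]

/-- The product of the Pauli operators `XY k` on qubit `i` for the entries `(i, k)` of a list. -/
def pauliString (L : List (Fin n × Fin 2)) : Matrix (Fin n → Fin 2) (Fin n → Fin 2) ℂ :=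
  (L.map fun p => onQubit (XY p.2) p.1).prod

theorem pauliString_cons (p : Fin n × Fin 2) (L : List (Fin n × Fin 2)) :
    pauliString (p :: L) = onQubit (XY p.2) p.1 * pauliString L := by
  simp [pauliString]

/-- The sign picked up when two one-qubit Pauli operators are exchanged. -/
def exchangeSign (p q : Fin n × Fin 2) : ℤ := if p.1 = q.1 ∧ p.2 ≠ q.2 then -1 else 1

/-- The sign picked up when two Pauli strings are exchanged. -/
def stringSign (L L' : List (Fin n × Fin 2)) : ℤ :=
  (L.map fun p => (L'.map (exchangeSign p)).prod).prod

theorem onQubit_XY_exchange (p q : Fin n × Fin 2) :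
    onQubit (XY p.2) p.1 * onQubit (XY q.2) q.1 =
      exchangeSign p q • (onQubit (XY q.2) q.1 * onQubit (XY p.2) p.1) := by
  obtain ⟨i, k⟩ := p
  obtain ⟨j, l⟩ := q
  unfold exchangeSign
  by_cases hij : i = j
  · subst hij
    by_cases hkl : k = l
    · subst hkl
      simp
    · simp [hkl, onQubit_mul, XY_anticommute hkl, onQubit_neg]
  · simp [hij, onQubit_commute _ _ hij]

theorem onQubit_XY_mul_pauliString (p : Fin n × Fin 2) (L : List (Fin n × Fin 2)) :
    onQubit (XY p.2) p.1 * pauliString L =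
      (L.map (exchangeSign p)).prod • (pauliString L * onQubit (XY p.2) p.1) := by
  induction L with
  | nil => simp [pauliString]
  | cons q L ih =>
    rw [pauliString_cons, ← mul_assoc, onQubit_XY_exchange, smul_mul_assoc, mul_assoc, ih,
      mul_smul_comm, smul_smul, List.map_cons, List.prod_cons, mul_assoc]

theorem pauliString_exchange (L L' : List (Fin n × Fin 2)) :
    pauliString L * pauliString L' = stringSign L L' • (pauliString L' * pauliString L) := by
  induction L with
  | nil => simp [pauliString, stringSign]
  | cons p L ih =>
    have hsign : stringSign (p :: L) L' =
        (L'.map (exchangeSign p)).prod * stringSign L L' := by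
      simp [stringSign]
    rw [pauliString_cons, hsign, mul_assoc, ih, mul_smul_comm, ← mul_assoc,
      onQubit_XY_mul_pauliString, smul_mul_assoc, smul_smul, mul_assoc,
      mul_comm (stringSign L L')]

theorem onQubit_XY_commute_pauliString {p : Fin n × Fin 2} {L : List (Fin n × Fin 2)}
    (h : p.1 ∉ L.map Prod.fst) :
    onQubit (XY p.2) p.1 * pauliString L = pauliString L * onQubit (XY p.2) p.1 := by
  rw [onQubit_XY_mul_pauliString, List.prod_eq_one, one_smul]
  simp only [List.mem_map, forall_exists_index, and_imp, forall_apply_eq_imp_iff₂]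
  intro q hq
  rw [exchangeSign, if_neg]
  rintro ⟨hpq, -⟩
  exact h (List.mem_map.2 ⟨q, hq, hpq.symm⟩)

theorem pauliString_conjTranspose {L : List (Fin n × Fin 2)} (h : (L.map Prod.fst).Nodup) :
    (pauliString L)ᴴ = pauliString L := by
  induction L with
  | nil => simp [pauliString]
  | cons p L ih =>
    rw [List.map_cons, List.nodup_cons] at h
    rw [pauliString_cons, Matrix.conjTranspose_mul, ih h.2, onQubit_conjTranspose,
      XY_conjTranspose, onQubit_XY_commute_pauliString h.1]

theorem pauliString_mul_self {L : List (Fin n × Fin 2)} (h : (L.map Prod.fst).Nodup) :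
    pauliString L * pauliString L = 1 := by
  induction L with
  | nil => simp [pauliString]
  | cons p L ih =>
    rw [List.map_cons, List.nodup_cons] at h
    rw [pauliString_cons]
    nth_rewrite 1 [onQubit_XY_commute_pauliString h.1]
    rw [mul_assoc, ← mul_assoc (onQubit _ _), onQubit_mul, XY_mul_self, onQubit_one, one_mul,
      ih h.2]

theorem sum_sq_pauliString_le_one {ι : Type*} [Fintype ι] [DecidableEq ι]
    {ρ : Matrix (Fin n → Fin 2) (Fin n → Fin 2) ℂ} (hρ : IsDensityMatrix ρ)
    (L : ι → List (Fin n × Fin 2)) (hnodup : ∀ i, ((L i).map Prod.fst).Nodup)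
    (hsign : ∀ i j, i ≠ j → stringSign (L i) (L j) = -1) :
    ∑ i, ((ρ * pauliString (L i)).trace.re) ^ 2 ≤ 1 :=
  sum_sq_expectation_le_one hρ.1 hρ.2 _ (fun i => pauliString_conjTranspose (hnodup i))
    (fun i => pauliString_mul_self (hnodup i)) fun i j hij => by
      rw [pauliString_exchange, hsign i j hij, neg_one_zsmul]

end Qubits

/-- The leaves joined to the root in the quadruple `j` of the copy `t`. -/
def treeLeaves (t : Fin 2) (j : Fin 4) : Fin 3 → Fin 9 :=
  ![![![1, 2, 3], ![2, 3, 4], ![3, 4, 1], ![4, 1, 2]],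
    ![![5, 6, 7], ![6, 7, 8], ![7, 8, 5], ![8, 5, 6]]] t j

/-- The letters on the leaves of the quadruple `j` in the class with parameters `a`, `b`; the two
strings of the class on a given quadruple are distinguished by `s`. -/
def treeLetters (a b : Fin 2) (j : Fin 4) (s : Fin 2) : Fin 3 → Fin 2 :=
  ![![s, b + s, a + s], ![b + s, a + 1 + s, a + b + s], ![a + s, a + b + s, 1 + s],
    ![a + b + s, s, b + 1 + s]] j

/-- The sixteen mutually anticommuting strings of the class with parameters `z`, `a`, `b`. -/
def treeString (z a b : Fin 2) (x : Fin 2 × Fin 4 × Fin 2) : List (Fin 9 × Fin 2) :=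
  [(0, z + x.1), (treeLeaves x.1 x.2.1 0, treeLetters a b x.2.1 x.2.2 0),
    (treeLeaves x.1 x.2.1 1, treeLetters a b x.2.1 x.2.2 1),
    (treeLeaves x.1 x.2.1 2, treeLetters a b x.2.1 x.2.2 2)]

theorem treeString_nodup (z a b : Fin 2) (x : Fin 2 × Fin 4 × Fin 2) :
    ((treeString z a b x).map Prod.fst).Nodup := by
  obtain ⟨t, j, s⟩ := x
  simp only [treeString, List.map_cons, List.map_nil]
  revert t j
  decide

theorem stringSign_treeString : ∀ (z a b : Fin 2) (x y : Fin 2 × Fin 4 × Fin 2), x ≠ y →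
    stringSign (treeString z a b x) (treeString z a b y) = -1 := by
  decide +kernel

/-- On a given quadruple, the letters of the strings of all classes run through all
possibilities. -/
theorem sum_treeLetters {M : Type*} [AddCommMonoid M] (F : Fin 2 → Fin 2 → Fin 2 → Fin 2 → M)
    (t : Fin 2) (j : Fin 4) :
    ∑ z, ∑ a, ∑ b, ∑ s, F (z + t) (treeLetters a b j s 0) (treeLetters a b j s 1)
      (treeLetters a b j s 2) = ∑ k₀, ∑ k₁, ∑ k₂, ∑ k₃, F k₀ k₁ k₂ k₃ := by
  have h : (1 : Fin 2) + 1 = 0 := rfl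
  fin_cases t <;> fin_cases j <;> simp [treeLetters, Fin.sum_univ_two, h] <;> abel

theorem sum_treeString (ρ : Matrix (Fin 9 → Fin 2) (Fin 9 → Fin 2) ℂ) :
    ∑ z, ∑ a, ∑ b, ∑ x, ((ρ * pauliString (treeString z a b x)).trace.re) ^ 2 =
      ∑ t, ∑ j, T2quad ρ 0 (treeLeaves t j 0) (treeLeaves t j 1) (treeLeaves t j 2) := by
  have h : ∀ t j, T2quad ρ 0 (treeLeaves t j 0) (treeLeaves t j 1) (treeLeaves t j 2) =
      ∑ z, ∑ a, ∑ b, ∑ s, ((ρ * pauliString (treeString z a b (t, j, s))).trace.re) ^ 2 := by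
    intro t j
    have hF := sum_treeLetters (fun k₀ k₁ k₂ k₃ => ((ρ * (onQubit (XY k₀) 0 *
      onQubit (XY k₁) (treeLeaves t j 0) * onQubit (XY k₂) (treeLeaves t j 1) *
        onQubit (XY k₃) (treeLeaves t j 2))).trace.re) ^ 2) t j
    rw [T2quad, ← hF]
    simp [pauliString, treeString, mul_assoc]
  simp only [h, Fintype.sum_prod_type, Fin.sum_univ_two, Fin.sum_univ_four]
  ring

/-- **Four-partite monogamy in the tree network.** For every 9-qubit density matrix
(qubits labeled 0,…,8 where 5,6,7,8 are copies 1̃,2̃,3̃,4̃ of 1,2,3,4),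
𝒯²₀₁₂₃ + 𝒯²₀₂₃₄ + 𝒯²₀₃₄₁ + 𝒯²₀₄₁₂ + 𝒯²₀₅₆₇ + 𝒯²₀₆₇₈ + 𝒯²₀₇₈₅ + 𝒯²₀₈₅₆ ≤ 8. -/
theorem tree_fourpartite_monogamy (ρ : Matrix (Fin 9 → Fin 2) (Fin 9 → Fin 2) ℂ)
    (hρ : IsDensityMatrix ρ) :
    T2quad ρ 0 1 2 3 + T2quad ρ 0 2 3 4 + T2quad ρ 0 3 4 1 + T2quad ρ 0 4 1 2 +
      T2quad ρ 0 5 6 7 + T2quad ρ 0 6 7 8 + T2quad ρ 0 7 8 5 + T2quad ρ 0 8 5 6 ≤ 8 := by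
  have hsum : ∑ z, ∑ a, ∑ b, ∑ x, ((ρ * pauliString (treeString z a b x)).trace.re) ^ 2 ≤
      ∑ _z : Fin 2, ∑ _a : Fin 2, ∑ _b : Fin 2, (1 : ℝ) :=
    Finset.sum_le_sum fun z _ => Finset.sum_le_sum fun a _ => Finset.sum_le_sum fun b _ =>
      sum_sq_pauliString_le_one hρ _ (treeString_nodup z a b) (stringSign_treeString z a b)
  rw [sum_treeString] at hsum
  simp only [Fin.sum_univ_two, Fin.sum_univ_four] at hsum
  have hval : T2quad ρ 0 1 2 3 + T2quad ρ 0 2 3 4 + T2quad ρ 0 3 4 1 + T2quad ρ 0 4 1 2 +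
      (T2quad ρ 0 5 6 7 + T2quad ρ 0 6 7 8 + T2quad ρ 0 7 8 5 + T2quad ρ 0 8 5 6) ≤
        1 + 1 + (1 + 1) + (1 + 1 + (1 + 1)) := hsum
  linarith
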